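/- arXiv:1910.04084 — 6 statements merged into one kernel-verified Lean document; each statement's English description precedes it below -/
import Mathlib

section
/- Let F be a field and let p(X) = X^e − a_{e−1}X^{e−1} − ⋯ − a_1X − a_0 be a monic polynomial of degree e ≥ 1 over F. Let v = (v_{j,r})_{j,r≥1} be a matrix over F such that: (i) for 1 ≤ r ≤ e, v_{j,r} = 0 whenever j > r and v_{r,r} ≠ 0 (the first e columns form a nonsingular upper triangular direction matrix); and (ii) for all j ≥ 1 and r ≥ 1, v_{j,r+e} = a_{e−1}·v_{j,r+e−1} + ⋯ + a_1·v_{j,r+1} + a_0·v_{j,r} + v_{j−e,r}, where v_{j−e,r} is read as 0 when j ≤ e (the Sobol' recurrence associated with p). Then the whole matrix is nonsingular upper triangular: for every r ≥ 1, v_{j,r} = 0 whenever j > r and v_{r,r} ≠ 0; moreover the diagonal is periodic with period e, i.e. v_{r+e,r+e} = v_{r,r} for all r ≥ 1. -/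
/-- for a monic polynomial `p(X) = X^e − a_{e−1}X^{e−1} − ⋯ − a_0` of degree
`e ≥ 1` over a field `F`, if a matrix `v = (v j r)_{j,r ≥ 1}` over `F` has its first `e`
columns forming a nonsingular upper triangular direction matrix (for `1 ≤ r ≤ e`:
`v j r = 0` for `j > r` and `v r r ≠ 0`) and its columns satisfy the Sobol' recurrence
associated with `p` (`v j (r+e) = a_{e−1} v j (r+e−1) + ⋯ + a_0 v j r + v (j−e) r` for all
`j, r ≥ 1`, with `v (j−e) r` read as `0` when `j ≤ e`), then the whole matrix is nonsingular
upper triangular (for every `r ≥ 1`: `v j r = 0` for `j > r` and `v r r ≠ 0`), and the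
diagonal is periodic with period `e`: `v (r+e) (r+e) = v r r` for all `r ≥ 1`. -/
theorem stmt_5 (F : Type*) [Field F] (e : ℕ) (he : 1 ≤ e) (a : ℕ → F)
    (v : ℕ → ℕ → F)
    (hNUT : ∀ r, 1 ≤ r → r ≤ e → (∀ j, r < j → v j r = 0) ∧ v r r ≠ 0)
    (hrec : ∀ j r, 1 ≤ j → 1 ≤ r →
      v j (r + e) = (∑ i ∈ Finset.range e, a i * v j (r + i)) +
        (if e < j then v (j - e) r else 0)) :
    (∀ r, 1 ≤ r → (∀ j, r < j → v j r = 0) ∧ v r r ≠ 0) ∧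
    (∀ r, 1 ≤ r → v (r + e) (r + e) = v r r) := by
  have hzero : ∀ r, 1 ≤ r → ∀ j, r < j → v j r = 0 := by
    intro r
    induction r using Nat.strong_induction_on with
    | _ r ih =>
      intro hr j hj
      rcases le_or_gt r e with h | h
      · exact (hNUT r hr h).1 j hj
      · obtain ⟨s, rfl⟩ := Nat.exists_eq_add_of_le' h.le
        rw [hrec j s (by omega) (by omega), if_pos (by omega),
          ih s (by omega) (by omega) (j - e) (by omega), add_zero]
        refine Finset.sum_eq_zero fun i hi => ?_
        have hi := Finset.mem_range.mp hi
        rw [ih (s + i) (by omega) (by omega) j (by omega), mul_zero]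
  have hdiag : ∀ r, 1 ≤ r → v (r + e) (r + e) = v r r := by
    intro r hr
    rw [hrec (r + e) r (by omega) hr, if_pos (by omega), Nat.add_sub_cancel,
      Finset.sum_eq_zero, zero_add]
    intro i hi
    have hi := Finset.mem_range.mp hi
    rw [hzero (r + i) (by omega) (r + e) (by omega), mul_zero]
  refine ⟨fun r hr => ⟨hzero r hr, ?_⟩, hdiag⟩
  induction r using Nat.strong_induction_on with
  | _ r ih =>
    rcases le_or_gt r e with h | h
    · exact (hNUT r hr h).2
    · obtain ⟨s, rfl⟩ := Nat.exists_eq_add_of_le' h.le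
      rw [hdiag s (by omega)]
      exact ih s (by omega) (by omega)
end

section
/- Let b be a prime and let C = (c_{j,r})_{j,r≥1} be a matrix over ℤ/bℤ that is nonsingular upper triangular (c_{j,r} = 0 for j > r and c_{r,r} ≠ 0 for all r). For n ∈ ℕ with base-b digits n = Σ_{r≥1} n_{r−1} b^{r−1}, define y_j(n) = Σ_{r≥1} c_{j,r}·n_{r−1} ∈ ℤ/bℤ and the point x_n = Σ_{j≥1} val(y_j(n))·b^{−j} ∈ [0,1) (both sums are finite). Then the sequence (x_n)_{n≥0} is a (0,1)-sequence in base b: for every m ≥ 0, every ℓ ≥ 0 and every integer a with 0 ≤ a < b^m, there is exactly one n with ℓ·b^m ≤ n < (ℓ+1)·b^m such that a·b^{−m} ≤ x_n < (a+1)·b^{−m}. -/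
/-- The integer whose base-`b` digits, most significant first, are `d 0, …, d (m - 1)`. -/
def leadingValue (b : ℕ) (d : ℕ → ℕ) : ℕ → ℕ
  | 0 => 0
  | m + 1 => b * leadingValue b d m + d m

section LeadingValue

variable {b : ℕ} {d d' : ℕ → ℕ}

theorem leadingValue_succ (m : ℕ) :
    leadingValue b d (m + 1) = b * leadingValue b d m + d m := rfl

theorem leadingValue_succ_div (hd : ∀ j, d j < b) (m : ℕ) :
    leadingValue b d (m + 1) / b = leadingValue b d m := by
  have hb : 0 < b := (Nat.zero_le _).trans_lt (hd 0)
  rw [leadingValue_succ, Nat.mul_add_div hb, Nat.div_eq_of_lt (hd m), add_zero]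

theorem leadingValue_add_div (hd : ∀ j, d j < b) (m k : ℕ) :
    leadingValue b d (m + k) / b ^ k = leadingValue b d m := by
  induction k with
  | zero => simp
  | succ k ih =>
    rw [pow_succ', ← Nat.div_div_eq_div_mul, ← add_assoc, leadingValue_succ_div hd, ih]

theorem leadingValue_lt (hd : ∀ j, d j < b) (m : ℕ) : leadingValue b d m < b ^ m := by
  induction m with
  | zero => simp [leadingValue]
  | succ m ih =>
    have := hd m
    rw [leadingValue_succ, pow_succ']
    nlinarith

theorem eq_of_leadingValue_eq (hd : ∀ j, d j < b) (hd' : ∀ j, d' j < b) {m : ℕ}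
    (h : leadingValue b d m = leadingValue b d' m) {j : ℕ} (hj : j < m) : d j = d' j := by
  induction m with
  | zero => omega
  | succ m ih =>
    have hm : leadingValue b d m = leadingValue b d' m := by
      rw [← leadingValue_succ_div hd, h, leadingValue_succ_div hd']
    rcases Nat.lt_succ_iff_lt_or_eq.mp hj with hj | rfl
    · exact ih hm hj
    · simpa [leadingValue_succ, hm] using h

theorem sum_digits_eq_leadingValue_div (hb : 0 < b) (m : ℕ) :
    ∑ j ∈ Finset.range m, (d j : ℝ) / (b : ℝ) ^ (j + 1) = leadingValue b d m / (b : ℝ) ^ m := by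
  have hb' : (b : ℝ) ≠ 0 := by positivity
  induction m with
  | zero => simp [leadingValue]
  | succ m ih =>
    rw [Finset.sum_range_succ, ih, leadingValue_succ]
    push_cast
    field_simp
    ring

/-- A real number with a finite base-`b` expansion lies in the elementary interval
`[a / b ^ m, (a + 1) / b ^ m)` exactly when its first `m` digits spell `a`. -/
theorem tsum_digits_mem_iff (hd : ∀ j, d j < b) {N : ℕ} (hN : ∀ j, N ≤ j → d j = 0) (m a : ℕ) :
    ((a : ℝ) / (b : ℝ) ^ m ≤ ∑' j, (d j : ℝ) / (b : ℝ) ^ (j + 1) ∧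
      ∑' j, (d j : ℝ) / (b : ℝ) ^ (j + 1) < ((a : ℝ) + 1) / (b : ℝ) ^ m) ↔
      leadingValue b d m = a := by
  have hb : 0 < b := (Nat.zero_le _).trans_lt (hd 0)
  have hbR : (0 : ℝ) < b := by exact_mod_cast hb
  have hsum : ∑' j, (d j : ℝ) / (b : ℝ) ^ (j + 1) =
      leadingValue b d (m + N) / (b : ℝ) ^ (m + N) := by
    rw [← sum_digits_eq_leadingValue_div hb]
    refine tsum_eq_sum fun j hj => ?_
    rw [hN j (by simp at hj; omega)]
    simp
  have hlow : (a : ℝ) / (b : ℝ) ^ m = (a * b ^ N : ℕ) / (b : ℝ) ^ (m + N) := by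
    push_cast; field_simp; ring
  have hhigh : ((a : ℝ) + 1) / (b : ℝ) ^ m = ((a + 1) * b ^ N : ℕ) / (b : ℝ) ^ (m + N) := by
    push_cast; field_simp; ring
  rw [hsum, hlow, hhigh, div_le_div_iff_of_pos_right (by positivity),
    div_lt_div_iff_of_pos_right (by positivity), Nat.cast_le, Nat.cast_lt,
    ← leadingValue_add_div hd m N, ← Nat.le_div_iff_mul_le (by positivity),
    ← Nat.div_lt_iff_lt_mul (by positivity)]
  omega

end LeadingValue

theorem sum_digits_range_eq {R : Type*} [Semiring R] {b : ℕ} (hb : 1 < b) (c : ℕ → R) {n N : ℕ}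
    (hN : n + 1 ≤ N) :
    ∑ r ∈ Finset.range (n + 1), c r * ((n / b ^ r % b : ℕ) : R) =
      ∑ r ∈ Finset.range N, c r * ((n / b ^ r % b : ℕ) : R) := by
  refine Finset.sum_subset (Finset.range_subset_range.mpr hN) fun r _ hr => ?_
  have hnr : n < b ^ r := lt_of_lt_of_le (by simp at hr; omega) (Nat.lt_pow_self hb).le
  simp [Nat.div_eq_of_lt hnr]

/-- One step of back substitution: if two integers agree above the `k`-th digit and a linear form
in the digits of index at least `k`, with nonzero `k`-th coefficient, takes the same value on both,
then they agree from the `k`-th digit on. -/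
theorem div_pow_eq_of_sum_digits_eq {b : ℕ} [Fact b.Prime] {c : ℕ → ZMod b} {k n n' : ℕ}
    (hc : ∀ r < k, c r = 0) (hck : c k ≠ 0)
    (hdiv : n / b ^ (k + 1) = n' / b ^ (k + 1))
    (hsum : ∑ r ∈ Finset.range (n + 1), c r * ((n / b ^ r % b : ℕ) : ZMod b) =
      ∑ r ∈ Finset.range (n' + 1), c r * ((n' / b ^ r % b : ℕ) : ZMod b)) :
    n / b ^ k = n' / b ^ k := by
  have hb : 1 < b := (Fact.out : b.Prime).one_lt
  rw [sum_digits_range_eq hb c (show n + 1 ≤ n + n' + k + 1 by omega),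
    sum_digits_range_eq hb c (show n' + 1 ≤ n + n' + k + 1 by omega),
    ← sub_eq_zero, ← Finset.sum_sub_distrib, Finset.sum_eq_single_of_mem k (by simp),
    ← mul_sub, mul_eq_zero, or_iff_right hck, sub_eq_zero, ZMod.natCast_eq_natCast_iff'] at hsum
  · rw [pow_succ, ← Nat.div_div_eq_div_mul, ← Nat.div_div_eq_div_mul] at hdiv
    rw [← Nat.div_add_mod (n / b ^ k) b, ← Nat.div_add_mod (n' / b ^ k) b, hdiv]
    simpa using hsum
  · intro r _ hrk
    rcases lt_or_gt_of_ne hrk with hlt | hgt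
    · simp [hc r hlt]
    · obtain ⟨s, rfl⟩ := Nat.exists_eq_add_of_le (Nat.succ_le_of_lt hgt)
      rw [pow_add, ← Nat.div_div_eq_div_mul, ← Nat.div_div_eq_div_mul, hdiv, sub_self]

/-- for a prime `b` and a nonsingular upper triangular matrix
`C = (c j r)_{j,r ≥ 1}` over `ℤ/bℤ`, the associated digital sequence
`x n = Σ_{j≥1} val(y j n)·b^{−j}`, where `y j n = Σ_{r≥1} c j r · n_{r−1}` and
`n = Σ_{r≥1} n_{r−1} b^{r−1}` is the base-`b` expansion of `n`, is a `(0,1)`-sequence in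
base `b`: for every `m ≥ 0`, `ℓ ≥ 0` and `0 ≤ a < b^m`, there is exactly one `n` with
`ℓ·b^m ≤ n < (ℓ+1)·b^m` such that `a·b^{−m} ≤ x n < (a+1)·b^{−m}`. -/
theorem stmt_6 (b : ℕ) [Fact b.Prime]
    (C : ℕ → ℕ → ZMod b)
    (hNUT : ∀ j r, 1 ≤ r → ((r < j → C j r = 0) ∧ C r r ≠ 0))
    (y : ℕ → ℕ → ZMod b)
    (hy : ∀ j n, y j n =
      ∑ r ∈ Finset.range (n + 1), C j (r + 1) * ((n / b ^ r % b : ℕ) : ZMod b))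
    (x : ℕ → ℝ)
    (hx : ∀ n, x n = ∑' j : ℕ, ((y (j + 1) n).val : ℝ) / (b : ℝ) ^ (j + 1)) :
    ∀ m ℓ a : ℕ, a < b ^ m →
      ∃! n : ℕ, (ℓ * b ^ m ≤ n ∧ n < (ℓ + 1) * b ^ m) ∧
        ((a : ℝ) / (b : ℝ) ^ m ≤ x n ∧ x n < ((a : ℝ) + 1) / (b : ℝ) ^ m) := by
  have hb : 1 < b := (Fact.out : b.Prime).one_lt
  have hd (n j : ℕ) : (y (j + 1) n).val < b := ZMod.val_lt _
  have hzero (n j : ℕ) (hj : n + 1 ≤ j) : (y (j + 1) n).val = 0 := by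
    rw [hy, Finset.sum_eq_zero, ZMod.val_zero]
    intro r hr
    rw [(hNUT (j + 1) (r + 1) (by omega)).1 (by simp at hr; omega), zero_mul]
  intro m ℓ a ha
  let A : ℕ → ℕ := fun n => leadingValue b (fun j => (y (j + 1) n).val) m
  have hmem (n : ℕ) :
      ((a : ℝ) / (b : ℝ) ^ m ≤ x n ∧ x n < ((a : ℝ) + 1) / (b : ℝ) ^ m) ↔ A n = a := by
    rw [hx]
    exact tsum_digits_mem_iff (hd n) (hzero n) m a
  have hblock (n : ℕ) (hn : n ∈ Finset.Ico (ℓ * b ^ m) ((ℓ + 1) * b ^ m)) : n / b ^ m = ℓ := by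
    rw [Finset.mem_Ico] at hn
    exact Nat.div_eq_of_lt_le hn.1 hn.2
  have hinj : Set.InjOn A (Finset.Ico (ℓ * b ^ m) ((ℓ + 1) * b ^ m)) := by
    intro n hn n' hn' hA
    have hdiv (i : ℕ) (hi : i ≤ m) : n / b ^ i = n' / b ^ i := by
      induction hi using Nat.decreasingInduction with
      | self => rw [hblock n hn, hblock n' hn']
      | of_succ k hk ih =>
        have hyk : y (k + 1) n = y (k + 1) n' :=
          ZMod.val_injective b (eq_of_leadingValue_eq (hd n) (hd n') hA hk)
        rw [hy, hy] at hyk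
        exact div_pow_eq_of_sum_digits_eq (c := fun r => C (k + 1) (r + 1))
          (fun r hr => (hNUT (k + 1) (r + 1) (by omega)).1 (by omega))
          (hNUT (k + 1) (k + 1) (by omega)).2 ih hyk
    simpa using hdiv 0 (Nat.zero_le m)
  have hsurj : Set.SurjOn A (Finset.Ico (ℓ * b ^ m) ((ℓ + 1) * b ^ m)) (Finset.range (b ^ m)) :=
    Finset.surjOn_of_injOn_of_card_le A
      (fun n _ => by simpa using leadingValue_lt (hd n) m) hinj (by simp [add_mul])
  obtain ⟨n, hn, hAn⟩ := hsurj (show a ∈ (Finset.range (b ^ m) : Set ℕ) by simpa using ha)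
  refine ⟨n, ⟨by simpa using hn, (hmem n).2 hAn⟩, fun n' hn' => ?_⟩
  exact hinj (by simpa using hn'.1) hn (((hmem n').1 hn'.2).trans hAn.symm)
end

section
/- Let b be a prime, s ≥ 1, and let C^{(1)},…,C^{(s)} be matrices over ℤ/bℤ (entries c^{(i)}_{j,r}, j,r ≥ 1), each with every column having only finitely many nonzero entries. Let (x_n)_{n≥0} in [0,1)^s be the associated digital sequence, with i-th coordinate x_n^{(i)} defined from C^{(i)}. Let m ≥ 0 and d_1,…,d_s ≥ 0 with D := d_1 + ⋯ + d_s ≤ m. Then the following are equivalent: (i) the first b^m points are (d_1,…,d_s)-equidistributed, i.e. for every choice of integers a_1,…,a_s with 0 ≤ a_i < b^{d_i}, exactly b^{m−D} of the points x_n with 0 ≤ n < b^m satisfy a_i·b^{−d_i} ≤ x_n^{(i)} < (a_i+1)·b^{−d_i} for all i; (ii) the D vectors (c^{(i)}_{j,1}, c^{(i)}_{j,2}, …, c^{(i)}_{j,m}) ∈ (ℤ/bℤ)^m, for 1 ≤ i ≤ s and 1 ≤ j ≤ d_i, are linearly independent over ℤ/bℤ. -/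
/-- The residues modulo `b` correspond to the base-`b` digits. -/
def zmodEquivFin (b : ℕ) [NeZero b] : ZMod b ≃ Fin b where
  toFun u := ⟨u.val, u.val_lt⟩
  invFun k := ((k : ℕ) : ZMod b)
  left_inv u := ZMod.natCast_zmod_val u
  right_inv k := Fin.ext (ZMod.val_cast_of_lt k.2)

/-- Digit vectors of length `m` correspond to the integers below `b ^ m`, the digit of lowest
index being the least significant one. -/
def littleEndianEquiv (b m : ℕ) [NeZero b] : (Fin m → ZMod b) ≃ Fin (b ^ m) :=
  ((Equiv.refl _).arrowCongr (zmodEquivFin b)).trans finFunctionFinEquiv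

/-- Digit vectors of length `d` correspond to the integers below `b ^ d`, the digit of lowest
index being the most significant one. -/
def bigEndianEquiv (b d : ℕ) [NeZero b] : (Fin d → ZMod b) ≃ Fin (b ^ d) :=
  (Fin.revPerm.arrowCongr (Equiv.refl _)).trans (littleEndianEquiv b d)

theorem bigEndianEquiv_apply_div (b d : ℕ) [NeZero b] (u : ℕ → ZMod b) :
    ((bigEndianEquiv b d (fun j => u j) : ℕ) : ℝ) / (b : ℝ) ^ d =
      ∑ j ∈ Finset.range d, ((u j).val : ℝ) / (b : ℝ) ^ (j + 1) := by
  have hb : (b : ℝ) ≠ 0 := Nat.cast_ne_zero.mpr (NeZero.ne b)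
  have h : (bigEndianEquiv b d (fun j => u j) : ℕ) =
      ∑ j : Fin d, (u (Fin.rev j)).val * b ^ (j : ℕ) := rfl
  rw [h, ← Equiv.sum_comp Fin.revPerm, ← Fin.sum_univ_eq_sum_range
    (fun j => ((u j).val : ℝ) / (b : ℝ) ^ (j + 1))]
  push_cast
  rw [Finset.sum_div]
  refine Finset.sum_congr rfl fun j _ => ?_
  have hj : (b : ℝ) ^ d = (b : ℝ) ^ (d - (j + 1)) * (b : ℝ) ^ ((j : ℕ) + 1) := by
    rw [← pow_add, Nat.sub_add_cancel j.2]
  simp only [Fin.revPerm_apply, Fin.rev_rev, Fin.val_rev]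
  rw [div_eq_div_iff (by positivity) (by positivity), hj, mul_assoc]

/-- A finite base-`b` expansion exceeds its truncation to `d` digits by less than `b ^ (-d)`. -/
theorem tsum_digits_sub_lt (b : ℕ) [NeZero b] (u : ℕ → ZMod b) (J : ℕ)
    (hu : ∀ j, J ≤ j → u j = 0) (d : ℕ) :
    ∑ j ∈ Finset.range d, ((u j).val : ℝ) / (b : ℝ) ^ (j + 1) ≤
        ∑' j : ℕ, ((u j).val : ℝ) / (b : ℝ) ^ (j + 1) ∧
      ∑' j : ℕ, ((u j).val : ℝ) / (b : ℝ) ^ (j + 1) <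
        ∑ j ∈ Finset.range d, ((u j).val : ℝ) / (b : ℝ) ^ (j + 1) + 1 / (b : ℝ) ^ d := by
  have hb : (0 : ℝ) < b := Nat.cast_pos.mpr (NeZero.pos b)
  have key : ∀ k, ∑ j ∈ Finset.range (d + k), ((u j).val : ℝ) / (b : ℝ) ^ (j + 1) ≤
      ∑ j ∈ Finset.range d, ((u j).val : ℝ) / (b : ℝ) ^ (j + 1) + 1 / (b : ℝ) ^ d
        - 1 / (b : ℝ) ^ (d + k) := by
    intro k
    induction k with
    | zero => simp
    | succ k ih =>
      rw [← add_assoc, Finset.sum_range_succ]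
      have hval : ((u (d + k)).val : ℝ) + 1 ≤ b := by exact_mod_cast (u (d + k)).val_lt
      have hstep : ((u (d + k)).val : ℝ) / (b : ℝ) ^ (d + k + 1) + 1 / (b : ℝ) ^ (d + k + 1) ≤
          1 / (b : ℝ) ^ (d + k) := by
        rw [← add_div, div_le_div_iff₀ (by positivity) (by positivity), pow_succ]
        nlinarith [pow_pos hb (d + k)]
      linarith
  rw [tsum_eq_sum (s := Finset.range (d + J)) fun j hj => by
    rw [hu j (by simp at hj; omega)]; simp]
  refine ⟨Finset.sum_le_sum_of_subset_of_nonneg (by simp) fun _ _ _ => by positivity, ?_⟩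
  have : 0 < 1 / (b : ℝ) ^ (d + J) := by positivity
  linarith [key J]

/-- The leading `d` digits of a number determine, and are determined by, the elementary interval
of length `b ^ (-d)` containing it. -/
theorem mem_elementary_interval_iff (b : ℕ) [NeZero b] (u : ℕ → ZMod b) (J : ℕ)
    (hu : ∀ j, J ≤ j → u j = 0) (d : ℕ) (w : Fin d → ZMod b) :
    (((bigEndianEquiv b d w : ℕ) : ℝ) / (b : ℝ) ^ d ≤
          ∑' j : ℕ, ((u j).val : ℝ) / (b : ℝ) ^ (j + 1) ∧
        ∑' j : ℕ, ((u j).val : ℝ) / (b : ℝ) ^ (j + 1) <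
          (((bigEndianEquiv b d w : ℕ) : ℝ) + 1) / (b : ℝ) ^ d) ↔
      ∀ j : Fin d, u j = w j := by
  have hb : (0 : ℝ) < (b : ℝ) ^ d := pow_pos (Nat.cast_pos.mpr (NeZero.pos b)) d
  obtain ⟨hl, hr⟩ := tsum_digits_sub_lt b u J hu d
  rw [← bigEndianEquiv_apply_div] at hl hr
  rw [← add_div] at hr
  constructor
  · rintro ⟨hl', hr'⟩
    have h₁ := (div_lt_div_iff_of_pos_right hb).mp (hl.trans_lt hr')
    have h₂ := (div_lt_div_iff_of_pos_right hb).mp (hl'.trans_lt hr)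
    norm_cast at h₁ h₂
    have h : bigEndianEquiv b d (fun j => u j) = bigEndianEquiv b d w := Fin.ext (by omega)
    exact congrFun ((bigEndianEquiv b d).injective h)
  · intro h
    rw [← funext h]
    exact ⟨hl, hr⟩

/-- The digit sum defining a digital sequence may be cut off at `m` for indices below `b ^ m`. -/
theorem sum_digits_eq_of_lt (b : ℕ) [Fact b.Prime] (c : ℕ → ZMod b) (m n : ℕ) (hn : n < b ^ m) :
    ∑ r ∈ Finset.range (n + 1), c r * ((n / b ^ r % b : ℕ) : ZMod b) =
      ∑ r : Fin m, c r * ((n / b ^ (r : ℕ) % b : ℕ) : ZMod b) := by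
  have hb : 1 < b := (Fact.out : b.Prime).one_lt
  have hz : ∀ r, n < b ^ r → c r * ((n / b ^ r % b : ℕ) : ZMod b) = 0 := fun r hr => by
    simp [Nat.div_eq_of_lt hr]
  rw [Fin.sum_univ_eq_sum_range (fun r => c r * ((n / b ^ r % b : ℕ) : ZMod b)) m,
    ← Finset.eventually_constant_sum (N := n + 1) (n := max (n + 1) m) _ (le_max_left _ _),
    ← Finset.eventually_constant_sum (N := m) (n := max (n + 1) m) _ (le_max_right _ _)]
  · exact fun r hr => hz r (hn.trans_le (Nat.pow_le_pow_right hb.le hr))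
  · exact fun r hr => hz r ((Nat.lt_of_succ_le hr).trans (Nat.lt_pow_self hb))

/-- The rows of a matrix over a field are linearly independent iff the matrix is surjective as a
linear map. -/
theorem Matrix.linearIndependent_row_iff_mulVecLin_surjective {K ι κ : Type*} [Field K]
    [Fintype ι] [Fintype κ] (M : Matrix ι κ K) :
    LinearIndependent K M.row ↔ Function.Surjective M.mulVecLin := by
  rw [linearIndependent_iff_card_eq_finrank_span, Set.finrank, ← Matrix.rank_eq_finrank_span_row,
    ← LinearMap.range_eq_top, Matrix.rank]
  constructor
  · intro h
    exact Submodule.eq_top_of_finrank_eq (by rw [← h, Module.finrank_fintype_fun_eq_card])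
  · intro h
    rw [h, finrank_top, Module.finrank_fintype_fun_eq_card]

/-- Over a finite field, the rows of a matrix are linearly independent iff every linear system
with that matrix has the expected number of solutions. -/
theorem Matrix.linearIndependent_row_iff_card_fiber {K ι κ : Type*} [Field K] [Finite K]
    [Fintype ι] [Fintype κ] (M : Matrix ι κ K) :
    LinearIndependent K M.row ↔
      ∀ w, Nat.card {v // M.mulVecLin v = w} =
        Nat.card K ^ (Fintype.card κ - Fintype.card ι) := by
  rw [M.linearIndependent_row_iff_mulVecLin_surjective]
  constructor
  · intro h w
    obtain ⟨v₀, rfl⟩ := h w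
    have e : {v // M.mulVecLin v = M.mulVecLin v₀} ≃ LinearMap.ker M.mulVecLin :=
      (Equiv.subRight v₀).subtypeEquiv fun v => by
        simp [LinearMap.mem_ker, map_sub, sub_eq_zero]
    have hrank := M.mulVecLin.finrank_range_add_finrank_ker
    rw [LinearMap.range_eq_top.mpr h, finrank_top, Module.finrank_fintype_fun_eq_card,
      Module.finrank_fintype_fun_eq_card] at hrank
    rw [Nat.card_congr e, Module.natCard_eq_pow_finrank (K := K)]
    congr 1
    omega
  · intro h w
    have hpos : Nat.card {v // M.mulVecLin v = w} ≠ 0 := by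
      rw [h w]
      exact pow_ne_zero _ Nat.card_pos.ne'
    obtain ⟨v, hv⟩ := (Nat.card_ne_zero.mp hpos).1
    exact ⟨v, hv⟩


/-- for a prime `b`, column-finite generating matrices `C⁽¹⁾,…,C⁽ˢ⁾` over
`ℤ/bℤ` with associated digital sequence `x`, and `m ≥ 0`, `d₁,…,d_s ≥ 0` with
`D = d₁ + ⋯ + d_s ≤ m`, the first `b^m` points are `(d₁,…,d_s)`-equidistributed (every
elementary box `Π_i [a_i b^{−d_i}, (a_i+1) b^{−d_i})` contains exactly `b^{m−D}` of them)
if and only if the `D` vectors `(c⁽ⁱ⁾_{j,1}, …, c⁽ⁱ⁾_{j,m})`, `1 ≤ i ≤ s`, `1 ≤ j ≤ d_i`,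
are linearly independent over `ℤ/bℤ`. -/
theorem stmt_7 (b : ℕ) [Fact b.Prime] (s : ℕ) (hs : 1 ≤ s)
    (C : Fin s → ℕ → ℕ → ZMod b)
    (hcolfin : ∀ i r, ∃ J, ∀ j, J < j → C i j r = 0)
    (y : Fin s → ℕ → ℕ → ZMod b)
    (hy : ∀ i j n, y i j n =
      ∑ r ∈ Finset.range (n + 1), C i j (r + 1) * ((n / b ^ r % b : ℕ) : ZMod b))
    (x : Fin s → ℕ → ℝ)
    (hx : ∀ i n, x i n = ∑' j : ℕ, ((y i (j + 1) n).val : ℝ) / (b : ℝ) ^ (j + 1))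
    (m : ℕ) (d : Fin s → ℕ) (hD : ∑ i, d i ≤ m) :
    (∀ aa : Fin s → ℕ, (∀ i, aa i < b ^ d i) →
        Nat.card {n : ℕ // n < b ^ m ∧ ∀ i,
          (aa i : ℝ) / (b : ℝ) ^ d i ≤ x i n ∧ x i n < ((aa i : ℝ) + 1) / (b : ℝ) ^ d i}
          = b ^ (m - ∑ i, d i)) ↔
      LinearIndependent (ZMod b)
        (fun jj : Σ i : Fin s, Fin (d i) =>
          (fun r : Fin m => C jj.1 ((jj.2 : ℕ) + 1) ((r : ℕ) + 1))) := by
  set M : Matrix (Σ i : Fin s, Fin (d i)) (Fin m) (ZMod b) :=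
    Matrix.of fun jj r => C jj.1 ((jj.2 : ℕ) + 1) ((r : ℕ) + 1)
  have hy' : ∀ i j (n : Fin (b ^ m)), y i j n =
      ∑ r : Fin m, C i j (r + 1) * (littleEndianEquiv b m).symm n r := fun i j n => by
    rw [hy, sum_digits_eq_of_lt b (fun r => C i j (r + 1)) m n n.2]
    rfl
  have hfin : ∀ i n, ∃ J, ∀ j, J ≤ j → y i (j + 1) n = 0 := fun i n => by
    choose J hJ using hcolfin i
    refine ⟨(Finset.range (n + 1)).sup fun r => J (r + 1), fun j hj => ?_⟩
    rw [hy]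
    refine Finset.sum_eq_zero fun r hr => ?_
    rw [hJ (r + 1) (j + 1), zero_mul]
    exact Nat.lt_succ_of_le ((Finset.le_sup (f := fun r => J (r + 1)) hr).trans hj)
  have hbox : ∀ w : (Σ i : Fin s, Fin (d i)) → ZMod b,
      Nat.card {n : ℕ // n < b ^ m ∧ ∀ i,
        ((bigEndianEquiv b (d i) fun j => w ⟨i, j⟩ : ℕ) : ℝ) / (b : ℝ) ^ d i ≤ x i n ∧
        x i n < (((bigEndianEquiv b (d i) fun j => w ⟨i, j⟩ : ℕ) : ℝ) + 1) / (b : ℝ) ^ d i} =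
      Nat.card {v // M.mulVecLin v = w} := fun w => by
    refine Nat.card_congr ((Equiv.subtypeSubtypeEquivSubtypeInter _ _).symm.trans
      ((Fin.equivSubtype.symm.trans (littleEndianEquiv b m).symm).subtypeEquiv ?_))
    rintro ⟨n, hn⟩
    have hrow : ∀ jj : Σ i : Fin s, Fin (d i),
        M.mulVecLin ((littleEndianEquiv b m).symm ⟨n, hn⟩) jj = y jj.1 (jj.2 + 1) n :=
      fun jj => (hy' jj.1 (jj.2 + 1) ⟨n, hn⟩).symm
    change _ ↔ M.mulVecLin ((littleEndianEquiv b m).symm ⟨n, hn⟩) = w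
    rw [funext_iff, Sigma.forall]
    refine forall_congr' fun i => ?_
    obtain ⟨J, hJ⟩ := hfin i n
    simp only [hrow, hx]
    exact mem_elementary_interval_iff b (fun j => y i (j + 1) n) J hJ (d i) _
  have hrows := M.linearIndependent_row_iff_card_fiber
  simp only [Nat.card_zmod, Fintype.card_fin, Fintype.card_sigma] at hrows
  refine Iff.trans ?_ hrows.symm
  constructor
  · intro h w
    rw [← hbox]
    exact h _ fun i => Fin.is_lt _
  · intro h aa haa
    obtain ⟨w, hw⟩ : ∃ w : (Σ i : Fin s, Fin (d i)) → ZMod b,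
        ∀ i, (bigEndianEquiv b (d i) fun j => w ⟨i, j⟩ : ℕ) = aa i :=
      ⟨fun jj => (bigEndianEquiv b (d jj.1)).symm ⟨aa jj.1, haa jj.1⟩ jj.2,
        fun i => congrArg Fin.val ((bigEndianEquiv b (d i)).apply_symm_apply ⟨aa i, haa i⟩)⟩
    simpa only [hw, h w] using hbox w
end

section
/- Let s ≥ 1 and let C^{(1)},…,C^{(s)} be matrices over ℤ/2ℤ (entries c^{(i)}_{j,r}, j,r ≥ 1), each with every column having only finitely many nonzero entries, and let (x_n)_{n≥0} in [0,1)^s be the associated digital sequence in base 2. Then the sequence satisfies Property A in dimension s — i.e., among the first 2^s points x_0,…,x_{2^s−1}, each of the 2^s subcubes Π_{i=1}^s [a_i/2, (a_i+1)/2) with a_i ∈ {0,1} contains exactly one point — if and only if the s×s matrix V over ℤ/2ℤ with entries V_{i,r} = c^{(i)}_{1,r} (1 ≤ i, r ≤ s), formed from the first s entries of the first row of each generating matrix, is invertible. -/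
/-- A binary expansion with some zero digit after the first lies in the half-open interval of
length `1/2` determined by its first digit. -/
theorem tsum_binary_digits_mem_half_interval_iff {d : ℕ → ℕ} (hd : ∀ j, d j < 2) {k : ℕ}
    (hk : d (k + 1) = 0) {a : ℕ} :
    ((a : ℝ) / 2 ≤ ∑' j, (d j : ℝ) / 2 ^ (j + 1) ∧
      ∑' j, (d j : ℝ) / 2 ^ (j + 1) < ((a : ℝ) + 1) / 2) ↔ d 0 = a := by
  have hgeom : HasSum (fun j : ℕ ↦ (1 : ℝ) / 2 ^ (j + 1)) 1 := by
    convert hasSum_geometric_two' 1 using 2 with j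
    rw [pow_succ]
    field_simp
  have hle : ∀ j, (d j : ℝ) / 2 ^ (j + 1) ≤ 1 / 2 ^ (j + 1) := fun j ↦ by
    have : (d j : ℝ) ≤ 1 := by exact_mod_cast Nat.le_of_lt_succ (hd j)
    gcongr
  have hsum : Summable fun j ↦ (d j : ℝ) / 2 ^ (j + 1) :=
    .of_nonneg_of_le (fun j ↦ by positivity) hle hgeom.summable
  have htail : ∑' j, (d (j + 1) : ℝ) / 2 ^ (j + 1 + 1) < 1 / 2 := by
    have hlt : ∑' j, (d (j + 1) : ℝ) / 2 ^ (j + 1 + 1) < ∑' j : ℕ, (1 : ℝ) / 2 ^ (j + 1 + 1) :=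
      Summable.tsum_lt_tsum (i := k) (fun j ↦ hle (j + 1)) (by simp [hk])
        (hsum.comp_injective (add_left_injective 1))
        (hgeom.summable.comp_injective (add_left_injective 1))
    have h1 := hgeom.summable.tsum_eq_zero_add
    rw [hgeom.tsum_eq] at h1
    norm_num at h1 hlt ⊢
    linarith
  have hnonneg : 0 ≤ ∑' j, (d (j + 1) : ℝ) / 2 ^ (j + 1 + 1) :=
    tsum_nonneg fun j ↦ by positivity
  rw [hsum.tsum_eq_zero_add]
  generalize ∑' j, (d (j + 1) : ℝ) / 2 ^ (j + 1 + 1) = t at htail hnonneg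
  constructor
  · rintro ⟨h1, h2⟩
    have h3 : (a : ℝ) < d 0 + 1 := by norm_num at h1; linarith
    have h4 : (d 0 : ℝ) < a + 1 := by norm_num at h2; linarith
    norm_cast at h3 h4
    omega
  · rintro rfl
    constructor <;> norm_num <;> linarith

/-- A sum weighted by the binary digits of `n < 2 ^ s` only involves the first `s` digits. -/
theorem sum_range_mul_binary_digit {R : Type*} [Semiring R] (f : ℕ → R) {n s : ℕ}
    (hn : n < 2 ^ s) :
    ∑ r ∈ Finset.range (n + 1), f r * ((n / 2 ^ r % 2 : ℕ) : R) =
      ∑ r : Fin s, f r * ((n / 2 ^ (r : ℕ) % 2 : ℕ) : R) := by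
  have key : ∀ m, n < 2 ^ m → ∀ l, m ≤ l →
      ∑ r ∈ Finset.range m, f r * ((n / 2 ^ r % 2 : ℕ) : R) =
        ∑ r ∈ Finset.range l, f r * ((n / 2 ^ r % 2 : ℕ) : R) := fun m hm l hl ↦ by
    refine Finset.sum_subset (Finset.range_mono hl) fun r _ hr ↦ ?_
    have : n < 2 ^ r := hm.trans_le (Nat.pow_le_pow_right two_pos (by simpa using hr))
    simp [Nat.div_eq_of_lt this]
  rw [Fin.sum_univ_eq_sum_range (fun r ↦ f r * ((n / 2 ^ r % 2 : ℕ) : R)),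
    key (n + 1) ((Nat.lt_two_pow_self).trans (Nat.pow_lt_pow_right one_lt_two n.lt_succ_self))
      _ (le_max_left _ s), key s hn _ (le_max_right (n + 1) _)]

/-- Every vector over `ZMod 2` is the digit vector of exactly one `n < 2 ^ s`. -/
theorem bijective_binary_digits (s : ℕ) :
    Function.Bijective fun (n : Fin (2 ^ s)) (r : Fin s) ↦
      (((n : ℕ) / 2 ^ (r : ℕ) % 2 : ℕ) : ZMod 2) := by
  refine (congrArg Function.Bijective ?_).mpr
    (finFunctionFinEquiv (m := 2) (n := s)).symm.bijective
  funext n r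
  apply Fin.ext
  change ZMod.val (n := 2) ((((n : ℕ) / 2 ^ (r : ℕ) % 2 : ℕ) : ZMod 2)) = _
  rw [ZMod.val_natCast, Nat.mod_mod]
  rfl

theorem Matrix.isUnit_iff_bijective_mulVec {n K : Type*} [Fintype n] [DecidableEq n] [Field K]
    {A : Matrix n n K} : IsUnit A ↔ Function.Bijective A.mulVec :=
  ⟨fun h ↦ ⟨Matrix.mulVec_injective_iff_isUnit.2 h, Matrix.mulVec_surjective_iff_isUnit.2 h⟩,
    fun h ↦ Matrix.mulVec_injective_iff_isUnit.1 h.1⟩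


/-- for column-finite generating matrices `C⁽¹⁾,…,C⁽ˢ⁾` over `ℤ/2ℤ` with
associated digital sequence `x` in base 2, the sequence satisfies Property A in dimension
`s` (each of the `2^s` subcubes `Π_i [a_i/2, (a_i+1)/2)`, `a_i ∈ {0,1}`, contains exactly
one of the first `2^s` points) if and only if the `s×s` matrix `V` over `ℤ/2ℤ` with
`V i r = c⁽ⁱ⁾_{1,r}` (`1 ≤ i, r ≤ s`), formed from the first `s` entries of the first row of
each generating matrix, is invertible. -/
theorem stmt_8 (s : ℕ) (hs : 1 ≤ s)
    (C : Fin s → ℕ → ℕ → ZMod 2)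
    (hcolfin : ∀ i r, ∃ J, ∀ j, J < j → C i j r = 0)
    (y : Fin s → ℕ → ℕ → ZMod 2)
    (hy : ∀ i j n, y i j n =
      ∑ r ∈ Finset.range (n + 1), C i j (r + 1) * ((n / 2 ^ r % 2 : ℕ) : ZMod 2))
    (x : Fin s → ℕ → ℝ)
    (hx : ∀ i n, x i n = ∑' j : ℕ, ((y i (j + 1) n).val : ℝ) / (2 : ℝ) ^ (j + 1)) :
    (∀ aa : Fin s → ℕ, (∀ i, aa i < 2) →
        ∃! n : ℕ, n < 2 ^ s ∧
          ∀ i, (aa i : ℝ) / 2 ≤ x i n ∧ x i n < ((aa i : ℝ) + 1) / 2) ↔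
      IsUnit (Matrix.of fun i r : Fin s => C i 1 ((r : ℕ) + 1)) := by

  set V := Matrix.of fun i r : Fin s => C i 1 ((r : ℕ) + 1)
  set digits := fun (n : Fin (2 ^ s)) (r : Fin s) ↦
    (((n : ℕ) / 2 ^ (r : ℕ) % 2 : ℕ) : ZMod 2)
  have hmem : ∀ (n i) (a : ℕ), ((a : ℝ) / 2 ≤ x i n ∧ x i n < ((a : ℝ) + 1) / 2) ↔
      (y i 1 n).val = a := fun n i a ↦ by
    choose J hJ using hcolfin i
    have hzero : y i ((Finset.range (n + 1)).sup (fun r ↦ J (r + 1)) + 1 + 1) n = 0 := by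
      rw [hy]
      refine Finset.sum_eq_zero fun r hr ↦ ?_
      have : J (r + 1) ≤ (Finset.range (n + 1)).sup fun r ↦ J (r + 1) :=
        Finset.le_sup (f := fun r ↦ J (r + 1)) hr
      rw [hJ (r + 1) _ (by omega), zero_mul]
    rw [hx]
    exact tsum_binary_digits_mem_half_interval_iff (d := fun j ↦ (y i (j + 1) n).val)
      (fun j ↦ ZMod.val_lt _) (by simpa using hzero)
  have hfirst : ∀ (n : Fin (2 ^ s)) i, y i 1 n = V.mulVec (digits n) i := fun n i ↦ by
    rw [hy, sum_range_mul_binary_digit (fun r ↦ C i 1 (r + 1)) n.isLt]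
    rfl
  rw [Matrix.isUnit_iff_bijective_mulVec,
    ← Function.Bijective.of_comp_iff _ (bijective_binary_digits s),
    Function.bijective_iff_existsUnique]
  have hcube : ∀ (aa : Fin s → ℕ) (v : Fin s → ZMod 2), (∀ i, (v i).val = aa i) →
      ((∃! n : ℕ, n < 2 ^ s ∧ ∀ i, (aa i : ℝ) / 2 ≤ x i n ∧ x i n < ((aa i : ℝ) + 1) / 2) ↔
        ∃! n, (V.mulVec ∘ digits) n = v) := fun aa v hv ↦ by
    have hpt : ∀ n : Fin (2 ^ s), (V.mulVec ∘ digits) n = v ↔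
        ∀ i, (aa i : ℝ) / 2 ≤ x i n ∧ x i n < ((aa i : ℝ) + 1) / 2 := fun n ↦ by
      simp only [hmem, ← hv, (ZMod.val_injective 2).eq_iff, hfirst, funext_iff,
        Function.comp_apply]
    simp only [hpt]
    constructor
    · rintro ⟨n, ⟨hn, h⟩, huniq⟩
      exact ⟨⟨n, hn⟩, h, fun m hm ↦ Fin.ext (huniq m ⟨m.isLt, hm⟩)⟩
    · rintro ⟨n, h, huniq⟩
      exact ⟨n, ⟨n.isLt, h⟩, fun m hm ↦ congrArg Fin.val (huniq ⟨m, hm.1⟩ hm.2)⟩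
  constructor
  · exact fun h v ↦ (hcube _ v fun _ ↦ rfl).1 (h _ fun i ↦ ZMod.val_lt (v i))
  · exact fun h aa haa ↦
      (hcube aa (fun i ↦ aa i) fun i ↦ ZMod.val_cast_of_lt (haa i)).2 (h _)
end

section
/- Let s ≥ 1 and let C^{(1)},…,C^{(s)} be matrices over ℤ/2ℤ (entries c^{(i)}_{j,r}, j,r ≥ 1), each with every column having only finitely many nonzero entries, and let (x_n)_{n≥0} in [0,1)^s be the associated digital sequence in base 2. Then the sequence satisfies Property A' in dimension s — i.e., among the first 2^{2s} points x_0,…,x_{2^{2s}−1}, each of the 2^{2s} subcubes Π_{i=1}^s [a_i/4, (a_i+1)/4) with a_i ∈ {0,1,2,3} contains exactly one point — if and only if the 2s×2s matrix over ℤ/2ℤ whose rows are the vectors (c^{(i)}_{j,1}, …, c^{(i)}_{j,2s}) for 1 ≤ i ≤ s and j ∈ {1,2} (the first 2s entries of the first two rows of each generating matrix) is invertible. -/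
open Finset in
/-- A finite dyadic expansion starting at the third digit is less than `1/4`. -/
lemma sum_range_dyadic_tail_lt (e : ℕ → ZMod 2) (N : ℕ) :
    ∑ j ∈ range N, ((e j).val : ℝ) / 2 ^ (j + 3) < 1 / 4 := by
  have key : ∑ j ∈ range N, ((e j).val : ℝ) / 2 ^ (j + 3) ≤ 1 / 4 - 1 / 2 ^ (N + 2) := by
    induction N with
    | zero => norm_num
    | succ N ih =>
      rw [sum_range_succ]
      have h1 : ((e N).val : ℝ) ≤ 1 := by
        exact_mod_cast Nat.le_of_lt_succ (ZMod.val_lt (e N))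
      have h2 : ((e N).val : ℝ) / 2 ^ (N + 3) ≤ 1 / 2 ^ (N + 3) := by gcongr
      have h3 : (1 : ℝ) / 2 ^ (N + 2) = 2 * (1 / 2 ^ (N + 3)) := by
        rw [pow_succ _ (N + 2)]; field_simp
      have h4 : N + 1 + 2 = N + 3 := rfl
      rw [h4]
      linarith
  have : (0 : ℝ) < 1 / 2 ^ (N + 2) := by positivity
  linarith

/-- A number with a finite dyadic expansion lies in the dyadic interval of length `1/4`
determined by its first two digits, and in no other. -/
lemma mem_quarter_interval_iff (e : ℕ → ZMod 2) (J : ℕ) (he : ∀ j, J ≤ j → e j = 0) (a : ℕ) :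
    ((a : ℝ) / 4 ≤ ∑' j : ℕ, ((e j).val : ℝ) / 2 ^ (j + 1) ∧
      ∑' j : ℕ, ((e j).val : ℝ) / 2 ^ (j + 1) < ((a : ℝ) + 1) / 4) ↔
      a = 2 * (e 0).val + (e 1).val := by
  have hsum : ∑' j : ℕ, ((e j).val : ℝ) / 2 ^ (j + 1) =
      ∑ j ∈ Finset.range (J + 2), ((e j).val : ℝ) / 2 ^ (j + 1) := by
    refine tsum_eq_sum fun j hj => ?_
    rw [he j (by simp at hj; omega)]
    simp
  rw [hsum, Finset.sum_range_succ', Finset.sum_range_succ']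
  have hlt := sum_range_dyadic_tail_lt (fun j => e (j + 2)) J
  have hnonneg : 0 ≤ ∑ j ∈ Finset.range J, ((e (j + 2)).val : ℝ) / 2 ^ (j + 3) :=
    Finset.sum_nonneg fun j _ => by positivity
  simp only [add_assoc, Nat.reduceAdd] at hlt hnonneg ⊢
  set t := ∑ j ∈ Finset.range J, ((e (j + 2)).val : ℝ) / 2 ^ (j + 3)
  generalize (e 0).val = p, (e 1).val = q
  norm_num
  constructor
  · rintro ⟨h1, h2⟩
    have h3 : (a : ℝ) < ((2 * p + q + 1 : ℕ) : ℝ) := by push_cast; linarith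
    have h4 : ((2 * p + q : ℕ) : ℝ) < ((a + 1 : ℕ) : ℝ) := by
      push_cast; linarith
    have h5 := Nat.cast_lt.mp h3
    have h6 := Nat.cast_lt.mp h4
    omega
  · rintro rfl
    push_cast
    constructor <;> linarith

/-- Binary digits, grouped in pairs, put the numbers below `2 ^ (2 * s)` in bijection with the
vectors over `ZMod 2` indexed by `Fin s × Fin 2`. -/
lemma existsUnique_lt_two_pow_iff {s : ℕ} (p : (Fin s × Fin 2 → ZMod 2) → Prop) :
    (∃! n : ℕ, n < 2 ^ (2 * s) ∧
      p fun k => ((n / 2 ^ (2 * (k.1 : ℕ) + (k.2 : ℕ)) % 2 : ℕ) : ZMod 2)) ↔ ∃! v, p v := by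
  let E : Fin (2 ^ (s * 2)) ≃ (Fin s × Fin 2 → ZMod 2) :=
    finFunctionFinEquiv.symm.trans (Equiv.arrowCongr finProdFinEquiv.symm (Equiv.refl (Fin 2)))
  have hE : ∀ n, E n =
      fun k => (((n : ℕ) / 2 ^ (2 * (k.1 : ℕ) + (k.2 : ℕ)) % 2 : ℕ) : ZMod 2) := by
    intro n
    funext k
    refine ZMod.val_injective 2 ?_
    rw [ZMod.val_natCast, Nat.mod_mod, add_comm]
    rfl
  rw [← E.existsUnique_congr_right, mul_comm 2 s]
  simp only [hE]
  constructor
  · rintro ⟨n, ⟨hn, hp⟩, huniq⟩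
    exact ⟨⟨n, hn⟩, hp, fun m hm => Fin.ext (huniq m ⟨m.2, hm⟩)⟩
  · rintro ⟨n, hp, huniq⟩
    exact ⟨n, ⟨n.2, hp⟩, fun m hm => congrArg Fin.val (huniq ⟨m, hm.1⟩ hm.2)⟩

/-- The digit sum defining a digital sequence only involves the first `N` columns when
`n < 2 ^ N`. -/
lemma sum_range_digits_eq {n N : ℕ} (hn : n < 2 ^ N) (c : ℕ → ZMod 2) :
    ∑ r ∈ Finset.range (n + 1), c r * ((n / 2 ^ r % 2 : ℕ) : ZMod 2) =
      ∑ r ∈ Finset.range N, c r * ((n / 2 ^ r % 2 : ℕ) : ZMod 2) := by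
  have hzero : ∀ r, n < 2 ^ r → c r * ((n / 2 ^ r % 2 : ℕ) : ZMod 2) = 0 := by
    intro r hr
    simp [Nat.div_eq_of_lt hr]
  have hext : ∀ K, n < 2 ^ K → ∀ L, K ≤ L →
      ∑ r ∈ Finset.range K, c r * ((n / 2 ^ r % 2 : ℕ) : ZMod 2) =
        ∑ r ∈ Finset.range L, c r * ((n / 2 ^ r % 2 : ℕ) : ZMod 2) := by
    intro K hK L hKL
    refine Finset.sum_subset (by simpa using hKL) fun r _ hr => hzero r ?_
    exact hK.trans_le (Nat.pow_le_pow_right two_pos (by simpa using hr))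
  have hn' : n < 2 ^ (n + 1) := Nat.lt_two_pow_self.trans (Nat.pow_lt_pow_succ one_lt_two)
  rw [hext _ hn' _ (le_max_left _ N), hext _ hn _ (le_max_right (n + 1) _)]

/-- Summation over `range (2 * s)` by pairs of consecutive indices. -/
lemma sum_range_two_mul_eq_sum_prod {M : Type*} [AddCommMonoid M] (s : ℕ) (f : ℕ → M) :
    ∑ r ∈ Finset.range (2 * s), f r =
      ∑ k : Fin s × Fin 2, f (2 * (k.1 : ℕ) + (k.2 : ℕ)) := by
  rw [mul_comm, ← Fin.sum_univ_eq_sum_range, ← finProdFinEquiv.sum_comp]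
  simp [add_comm]

/-- A square matrix over a field is invertible iff each linear system it defines has exactly one
solution. -/
lemma Matrix.isUnit_iff_forall_existsUnique_mulVec {n K : Type*} [Fintype n] [DecidableEq n]
    [Field K] (A : Matrix n n K) : IsUnit A ↔ ∀ w, ∃! v, A.mulVec v = w := by
  rw [← Function.bijective_iff_existsUnique]
  exact ⟨fun h => ⟨Matrix.mulVec_injective_iff_isUnit.mpr h,
    Matrix.mulVec_surjective_iff_isUnit.mpr h⟩, fun h => Matrix.mulVec_injective_iff_isUnit.mp h.1⟩


/-- for column-finite generating matrices `C⁽¹⁾,…,C⁽ˢ⁾` over `ℤ/2ℤ` with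
associated digital sequence `x` in base 2, the sequence satisfies Property A' in dimension
`s` (each of the `2^{2s}` subcubes `Π_i [a_i/4, (a_i+1)/4)`, `a_i ∈ {0,1,2,3}`, contains
exactly one of the first `2^{2s}` points) if and only if the `2s×2s` matrix over `ℤ/2ℤ`
whose rows are the vectors `(c⁽ⁱ⁾_{j,1}, …, c⁽ⁱ⁾_{j,2s})` for `1 ≤ i ≤ s`, `j ∈ {1,2}`
(the first `2s` entries of the first two rows of each generating matrix, the `2s` columns
being indexed here by pairs `(i',j') ↦ 2i'+j'+1`) is invertible. -/
theorem stmt_9 (s : ℕ) (hs : 1 ≤ s)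
    (C : Fin s → ℕ → ℕ → ZMod 2)
    (hcolfin : ∀ i r, ∃ J, ∀ j, J < j → C i j r = 0)
    (y : Fin s → ℕ → ℕ → ZMod 2)
    (hy : ∀ i j n, y i j n =
      ∑ r ∈ Finset.range (n + 1), C i j (r + 1) * ((n / 2 ^ r % 2 : ℕ) : ZMod 2))
    (x : Fin s → ℕ → ℝ)
    (hx : ∀ i n, x i n = ∑' j : ℕ, ((y i (j + 1) n).val : ℝ) / (2 : ℝ) ^ (j + 1)) :
    (∀ aa : Fin s → ℕ, (∀ i, aa i < 4) →
        ∃! n : ℕ, n < 2 ^ (2 * s) ∧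
          ∀ i, (aa i : ℝ) / 4 ≤ x i n ∧ x i n < ((aa i : ℝ) + 1) / 4) ↔
      IsUnit (Matrix.of fun rowIdx colIdx : Fin s × Fin 2 =>
        C rowIdx.1 ((rowIdx.2 : ℕ) + 1) (2 * (colIdx.1 : ℕ) + (colIdx.2 : ℕ) + 1)) := by
  set A : Matrix (Fin s × Fin 2) (Fin s × Fin 2) (ZMod 2) := Matrix.of fun rowIdx colIdx =>
    C rowIdx.1 ((rowIdx.2 : ℕ) + 1) (2 * (colIdx.1 : ℕ) + (colIdx.2 : ℕ) + 1) with hA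
  have hmul : ∀ n, n < 2 ^ (2 * s) → ∀ k : Fin s × Fin 2, y k.1 ((k.2 : ℕ) + 1) n =
      A.mulVec (fun l => ((n / 2 ^ (2 * (l.1 : ℕ) + (l.2 : ℕ)) % 2 : ℕ) : ZMod 2)) k := by
    intro n hn k
    rw [hy, sum_range_digits_eq hn fun r => C k.1 ((k.2 : ℕ) + 1) (r + 1),
      sum_range_two_mul_eq_sum_prod]
    rfl
  have hfin : ∀ i n, ∃ J, ∀ j, J ≤ j → y i (j + 1) n = 0 := by
    intro i n
    choose J hJ using hcolfin i
    refine ⟨(Finset.range (n + 1)).sup fun r => J (r + 1), fun j hj => ?_⟩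
    rw [hy]
    refine Finset.sum_eq_zero fun r hr => ?_
    have : J (r + 1) ≤ j := (Finset.le_sup (f := fun r => J (r + 1)) hr).trans hj
    rw [hJ (r + 1) (j + 1) (by omega), zero_mul]
  have hmem : ∀ (a : ℕ) i n, ((a : ℝ) / 4 ≤ x i n ∧ x i n < ((a : ℝ) + 1) / 4) ↔
      a = 2 * (y i 1 n).val + (y i 2 n).val := by
    intro a i n
    obtain ⟨J, hJ⟩ := hfin i n
    rw [hx]
    exact mem_quarter_interval_iff (fun j => y i (j + 1) n) J hJ a
  have hsystem : ∀ (aa : Fin s → ℕ) (w : Fin s × Fin 2 → ZMod 2),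
      (∀ i, aa i = 2 * (w (i, 0)).val + (w (i, 1)).val) →
      ((∃! n : ℕ, n < 2 ^ (2 * s) ∧
          ∀ i, (aa i : ℝ) / 4 ≤ x i n ∧ x i n < ((aa i : ℝ) + 1) / 4) ↔
        ∃! v, A.mulVec v = w) := by
    intro aa w haw
    rw [← existsUnique_lt_two_pow_iff fun v => A.mulVec v = w]
    refine existsUnique_congr fun n => and_congr_right fun hn => ?_
    simp only [hmem, haw, funext_iff, Prod.forall, Fin.forall_fin_two, ← hmul n hn]
    refine forall_congr' fun i => ?_
    have h0 := ZMod.val_lt (w (i, 0))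
    have h1 := ZMod.val_lt (w (i, 1))
    have h2 := ZMod.val_lt (y i 1 n)
    have h3 := ZMod.val_lt (y i 2 n)
    rw [← (ZMod.val_injective 2).eq_iff, ← (ZMod.val_injective 2).eq_iff]
    simp only [Fin.val_zero, Fin.val_one, zero_add, Nat.reduceAdd]
    omega
  rw [A.isUnit_iff_forall_existsUnique_mulVec]
  constructor
  · intro h w
    refine (hsystem _ w fun i => rfl).mp (h _ fun i => ?_)
    have h0 := ZMod.val_lt (w (i, 0))
    have h1 := ZMod.val_lt (w (i, 1))
    omega
  · intro h aa haa
    refine (hsystem aa (fun k => ![((aa k.1 / 2 : ℕ) : ZMod 2), ((aa k.1 : ℕ) : ZMod 2)] k.2)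
      fun i => ?_).mpr (h _)
    have := haa i
    simp only [Matrix.cons_val_zero, Matrix.cons_val_one, ZMod.val_natCast]
    omega
end

section
/- Let s ≥ 1 and let p_1,…,p_s be pairwise distinct monic polynomials over ℤ/2ℤ of degrees e_1,…,e_s ≥ 1, each of which is either X or a primitive polynomial (i.e. p_i is irreducible and the residue class of X in the field (ℤ/2ℤ)[X]/(p_i) has multiplicative order 2^{e_i} − 1). For each i, let D^{(i)} be any nonsingular upper triangular e_i×e_i matrix over ℤ/2ℤ (a choice of direction numbers), and let C^{(i)} = (v^{(i)}_{j,r})_{j,r≥1} be the matrix whose upper-left e_i×e_i block is D^{(i)}, with v^{(i)}_{j,r} = 0 for j > r when r ≤ e_i, and whose remaining columns are defined by the Sobol' recurrence associated with p_i(X) = X^{e_i} − a^{(i)}_{e_i−1}X^{e_i−1} − ⋯ − a^{(i)}_0: v^{(i)}_{j,r+e_i} = a^{(i)}_{e_i−1}·v^{(i)}_{j,r+e_i−1} + ⋯ + a^{(i)}_0·v^{(i)}_{j,r} + v^{(i)}_{j−e_i,r} for all j, r ≥ 1 (with v^{(i)}_{j−e_i,r} = 0 when j ≤ e_i). Let (x_n)_{n≥0}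 in [0,1)^s be the digital sequence in base 2 associated with C^{(1)},…,C^{(s)}, and set t := Σ_{i=1}^s (e_i − 1). Then (x_n) is a (t,s)-sequence in base 2: for every m ≥ t, every ℓ ≥ 0, every choice of integers d_1,…,d_s ≥ 0 with d_1 + ⋯ + d_s = m − t, and every choice of integers a_1,…,a_s with 0 ≤ a_i < 2^{d_i}, exactly 2^t of the points x_n with ℓ·2^m ≤ n < (ℓ+1)·2^m satisfy a_i·2^{−d_i} ≤ x_n^{(i)} < (a_i+1)·2^{−d_i} for all 1 ≤ i ≤ s. -/
open Polynomial in
/-- The linear functional on polynomials sending `X ^ r` to `w r`. -/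
noncomputable def coeffFunctional {K : Type*} [Field K] (w : ℕ → K) : K[X] →ₗ[K] K :=
  (Polynomial.basisMonomials K).constr K w

namespace coeffFunctional

open Polynomial

variable {K : Type*} [Field K]

theorem apply_monomial (w : ℕ → K) (r : ℕ) (c : K) :
    coeffFunctional w (monomial r c) = c * w r := by
  have h : (monomial r c : K[X]) = c • Polynomial.basisMonomials K r := by
    simp [smul_monomial]
  rw [h, map_smul, coeffFunctional, Module.Basis.constr_basis, smul_eq_mul]

theorem apply_eq_sum (w : ℕ → K) {f : K[X]} {m : ℕ} (hf : f.degree < m) :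
    coeffFunctional w f = ∑ r : Fin m, w r * f.coeff r := by
  have h : f = ∑ r ∈ Finset.range m, monomial r (f.coeff r) := by
    ext k
    simp only [finsetSum_coeff, coeff_monomial, Finset.sum_ite_eq', Finset.mem_range]
    split_ifs with hk
    · rfl
    · exact coeff_eq_zero_of_degree_lt (hf.trans_le (by exact_mod_cast not_lt.mp hk))
  conv_lhs => rw [h]
  rw [map_sum, ← Fin.sum_univ_eq_sum_range (fun r => coeffFunctional w (monomial r (f.coeff r)))]
  simp [apply_monomial, mul_comm]

end coeffFunctional

section SobolMatrix

open Polynomial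

variable {K : Type*} [Field K] {p : K[X]} {e : ℕ} {a : ℕ → K} {v : ℕ → ℕ → K}

theorem sobol_upper_triangular (he : 1 ≤ e)
    (hNUT : ∀ r, 1 ≤ r → r ≤ e → (∀ j, r < j → v j r = 0) ∧ v r r ≠ 0)
    (hrec : ∀ j r, 1 ≤ j → 1 ≤ r →
      v j (r + e) = (∑ k ∈ Finset.range e, a k * v j (r + k)) +
        (if e < j then v (j - e) r else 0)) :
    ∀ r, 1 ≤ r → (∀ j, r < j → v j r = 0) ∧ v r r ≠ 0 := by
  intro r
  induction r using Nat.strong_induction_on with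
  | _ r ih =>
    intro hr
    rcases le_or_gt r e with hre | hre
    · exact hNUT r hr hre
    obtain ⟨q, rfl⟩ : ∃ q, r = q + e := ⟨r - e, by omega⟩
    have hq : 1 ≤ q := by omega
    have hsum : ∀ j, q + e ≤ j → ∑ k ∈ Finset.range e, a k * v j (q + k) = 0 := by
      intro j hj
      refine Finset.sum_eq_zero fun k hk => ?_
      rw [Finset.mem_range] at hk
      rw [(ih (q + k) (by omega) (by omega)).1 j (by omega), mul_zero]
    refine ⟨fun j hj => ?_, ?_⟩
    · rw [hrec j q (by omega) hq, hsum j hj.le, zero_add, if_pos (by omega)]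
      exact (ih q (by omega) hq).1 _ (by omega)
    · rw [hrec _ q (by omega) hq, hsum _ le_rfl, zero_add, if_pos (by omega), Nat.add_sub_cancel]
      exact (ih q (by omega) hq).2

theorem sobol_functional_mul
    (ha : p = X ^ e - ∑ k ∈ Finset.range e, C (a k) * X ^ k)
    (hrec : ∀ j r, 1 ≤ j → 1 ≤ r →
      v j (r + e) = (∑ k ∈ Finset.range e, a k * v j (r + k)) +
        (if e < j then v (j - e) r else 0))
    {j : ℕ} (hj : 1 ≤ j) (f : K[X]) :
    coeffFunctional (fun r => v j (r + 1)) (p * f) =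
      if e < j then coeffFunctional (fun r => v (j - e) (r + 1)) f else 0 := by
  induction f using Polynomial.induction_on' with
  | add f g hf hg =>
    rw [mul_add, map_add, hf, hg]
    split_ifs <;> simp
  | monomial r c =>
    have h : p * monomial r c = monomial (r + e) c -
        ∑ k ∈ Finset.range e, monomial (r + k) (a k * c) := by
      rw [ha, sub_mul, Finset.sum_mul]
      congr 1
      · rw [X_pow_eq_monomial, monomial_mul_monomial, one_mul, add_comm]
      · refine Finset.sum_congr rfl fun k _ => ?_
        rw [C_mul_X_pow_eq_monomial, monomial_mul_monomial, add_comm]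
    have h2 := hrec j (r + 1) hj (by omega)
    simp only [h, map_sub, map_sum, coeffFunctional.apply_monomial]
    rw [show r + e + 1 = r + 1 + e by ring, h2, mul_add, Finset.mul_sum]
    have h3 : ∑ k ∈ Finset.range e, a k * c * v j (r + k + 1) =
        ∑ k ∈ Finset.range e, c * (a k * v j (r + 1 + k)) :=
      Finset.sum_congr rfl fun k _ => by
        rw [show r + k + 1 = r + 1 + k by ring]; ring
    rw [h3, add_sub_cancel_left, mul_ite, mul_zero]

theorem sobol_functional_eq_zero_of_pow_dvd
    (ha : p = X ^ e - ∑ k ∈ Finset.range e, C (a k) * X ^ k)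
    (hrec : ∀ j r, 1 ≤ j → 1 ≤ r →
      v j (r + e) = (∑ k ∈ Finset.range e, a k * v j (r + k)) +
        (if e < j then v (j - e) r else 0))
    {q j : ℕ} (hj : 1 ≤ j) (hjq : j ≤ q * e) {f : K[X]} (hf : p ^ q ∣ f) :
    coeffFunctional (fun r => v j (r + 1)) f = 0 := by
  obtain ⟨g, rfl⟩ := hf
  induction q generalizing j with
  | zero => omega
  | succ q ih =>
    rw [pow_succ', mul_assoc, sobol_functional_mul ha hrec hj]
    split_ifs with h
    · exact ih (by omega) (by rw [add_mul, one_mul] at hjq; omega)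
    · rfl

theorem exists_polynomial_of_upper_triangular
    (hv : ∀ r, 1 ≤ r → (∀ j, r < j → v j r = 0) ∧ v r r ≠ 0) (N : ℕ) (b : ℕ → K) :
    ∃ f : K[X], (∀ j, N < j → coeffFunctional (fun r => v j (r + 1)) f = 0) ∧
      ∀ j, 1 ≤ j → j ≤ N → coeffFunctional (fun r => v j (r + 1)) f = b j := by
  induction N generalizing b with
  | zero => exact ⟨0, fun j _ => map_zero _, fun j h1 h2 => by omega⟩
  | succ N ih =>
    obtain ⟨hz, hne⟩ := hv (N + 1) (by omega)
    set c := b (N + 1) / v (N + 1) (N + 1) with hc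
    obtain ⟨f, hf0, hf⟩ := ih fun j => b j - c * v j (N + 1)
    refine ⟨f + monomial N c, fun j hj => ?_, fun j h1 h2 => ?_⟩
    · rw [map_add, hf0 j (by omega), coeffFunctional.apply_monomial, hz j hj, mul_zero, add_zero]
    · rw [map_add, coeffFunctional.apply_monomial]
      rcases Nat.lt_or_ge N j with h | h
      · obtain rfl : j = N + 1 := by omega
        rw [hf0 _ (by omega), zero_add, hc, div_mul_cancel₀ _ hne]
      · rw [hf j h1 h, sub_add_cancel]

end SobolMatrix

open Polynomial in
/-- Rows of Sobol matrices belonging to pairwise distinct monic irreducible polynomials attain arbitrary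
values simultaneously on polynomials of small degree. -/
theorem sobol_rows_surjective {K ι : Type*} [Field K] [Fintype ι] {p : ι → K[X]}
    (hmonic : ∀ i, (p i).Monic) (hirr : ∀ i, Irreducible (p i)) (hdist : Function.Injective p)
    {e : ι → ℕ} (he : ∀ i, 1 ≤ e i) (hdeg : ∀ i, e i = (p i).natDegree)
    {a : ι → ℕ → K}
    (ha : ∀ i, p i = X ^ e i - ∑ k ∈ Finset.range (e i), C (a i k) * X ^ k)
    {v : ι → ℕ → ℕ → K}
    (hNUT : ∀ i r, 1 ≤ r → r ≤ e i → (∀ j, r < j → v i j r = 0) ∧ v i r r ≠ 0)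
    (hrec : ∀ i j r, 1 ≤ j → 1 ≤ r →
      v i j (r + e i) = (∑ k ∈ Finset.range (e i), a i k * v i j (r + k)) +
        (if e i < j then v i (j - e i) r else 0))
    {d : ι → ℕ} {m : ℕ} (hm : ∑ i, d i + ∑ i, (e i - 1) ≤ m) (b : ι → ℕ → K) :
    ∃ g : Fin m → K, ∀ i j, j < d i → ∑ r : Fin m, v i (j + 1) (r + 1) * g r = b i j := by
  have hcop : Pairwise fun i i' => IsCoprime (p i) (p i') := by
    intro i i' hne
    rw [(hirr i).coprime_iff_not_dvd]
    intro hdvd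
    exact hne (hdist (eq_of_monic_of_associated (hmonic i) (hmonic i')
      ((hirr i).associated_of_dvd (hirr i') hdvd)))
  set q : ι → ℕ := fun i => (d i + (e i - 1)) / e i with hq
  have hq1 : ∀ i, d i ≤ q i * e i := fun i => by
    have h := Nat.div_add_mod (d i + (e i - 1)) (e i)
    have h2 := Nat.mod_lt (d i + (e i - 1)) (he i)
    rw [mul_comm] at h
    simp only [hq]
    omega
  have hq2 : ∀ i, q i * e i ≤ d i + (e i - 1) := fun i => Nat.div_mul_le_self _ _
  choose f _ hf using fun i => exists_polynomial_of_upper_triangular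
    (sobol_upper_triangular (he i) (hNUT i) (hrec i)) (d i) (fun j => b i (j - 1))
  obtain ⟨F, hF⟩ := Ideal.exists_forall_sub_mem_ideal
    (I := fun i => Ideal.span {p i ^ q i})
    (fun i _ hne => (Ideal.isCoprime_span_singleton_iff _ _).mpr (hcop hne).pow) f
  set P : K[X] := ∏ i, p i ^ q i with hP
  have hPm : P.Monic := monic_prod_of_monic _ _ fun i _ => (hmonic i).pow _
  have hPdeg : P.natDegree ≤ m := by
    rw [hP, natDegree_prod_of_monic _ _ fun i _ => (hmonic i).pow _]
    refine le_trans ?_ hm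
    rw [← Finset.sum_add_distrib]
    refine Finset.sum_le_sum fun i _ => ?_
    rw [natDegree_pow, ← hdeg]
    exact hq2 i
  have hdegF : (F %ₘ P).degree < m := by
    refine (degree_modByMonic_lt F hPm).trans_le ?_
    rw [degree_eq_natDegree hPm.ne_zero]
    exact_mod_cast hPdeg
  refine ⟨fun r => (F %ₘ P).coeff r, fun i j hj => ?_⟩
  rw [← coeffFunctional.apply_eq_sum (fun r => v i (j + 1) (r + 1)) hdegF]
  have hdvd : p i ^ q i ∣ F %ₘ P - f i := by
    have h1 : p i ^ q i ∣ F - f i := Ideal.mem_span_singleton.mp (hF i)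
    have h2 : p i ^ q i ∣ P := Finset.dvd_prod_of_mem _ (Finset.mem_univ i)
    have h3 : F %ₘ P - f i = F - f i - P * (F /ₘ P) := by
      rw [modByMonic_eq_sub_mul_div]; ring
    rw [h3]
    exact dvd_sub h1 (h2.mul_right _)
  have hz := sobol_functional_eq_zero_of_pow_dvd (ha i) (hrec i) (j := j + 1) (by omega)
    (le_trans (by omega) (hq1 i)) hdvd
  rw [map_sub, sub_eq_zero] at hz
  rw [hz, hf i (j + 1) (by omega) (by omega), Nat.add_sub_cancel]

/-- All fibres of a surjective linear system over `ℤ/2ℤ` have the same cardinality. -/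
theorem card_solutions_of_surjective {κ : Type*} [Fintype κ] {m t : ℕ}
    (hcard : Fintype.card κ + t = m) (M : Matrix κ (Fin m) (ZMod 2))
    (hsurj : Function.Surjective M.mulVec) (b : κ → ZMod 2) :
    Nat.card {g : Fin m → ZMod 2 // M.mulVec g = b} = 2 ^ t := by
  obtain ⟨g₀, rfl⟩ := hsurj b
  have hker : Nat.card (LinearMap.ker M.mulVecLin) = 2 ^ t := by
    have h := M.mulVecLin.finrank_range_add_finrank_ker
    rw [LinearMap.range_eq_top.mpr hsurj, finrank_top, Module.finrank_fintype_fun_eq_card,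
      Module.finrank_fintype_fun_eq_card, Fintype.card_fin] at h
    rw [Module.natCard_eq_pow_finrank (K := ZMod 2), Nat.card_zmod]
    congr 1
    omega
  rw [← hker]
  refine Nat.card_congr ((Equiv.subRight g₀).subtypeEquiv fun g => ?_)
  simp [Matrix.mulVec_sub, sub_eq_zero]

theorem sum_binary_digits_eq_iff {w : ℕ → ℕ} (hw : ∀ j, w j < 2) (d a : ℕ) (ha : a < 2 ^ d) :
    ∑ j ∈ Finset.range d, w j * 2 ^ (d - 1 - j) = a ↔
      ∀ j, j < d → w j = a / 2 ^ (d - 1 - j) % 2 := by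
  induction d generalizing a with
  | zero => simp at ha; simp [ha]
  | succ d ih =>
    have hsum : ∑ j ∈ Finset.range (d + 1), w j * 2 ^ (d + 1 - 1 - j) =
        2 * ∑ j ∈ Finset.range d, w j * 2 ^ (d - 1 - j) + w d := by
      rw [Finset.sum_range_succ, Finset.mul_sum]
      congr 1
      · refine Finset.sum_congr rfl fun j hj => ?_
        rw [Finset.mem_range] at hj
        rw [show d + 1 - 1 - j = d - 1 - j + 1 by omega, pow_succ]
        ring
      · simp
    have hih := ih (a / 2) (by rw [pow_succ] at ha; omega)
    have hwd := hw d
    have hdig : ∀ j, j < d → a / 2 / 2 ^ (d - 1 - j) = a / 2 ^ (d + 1 - 1 - j) := by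
      intro j hj
      rw [Nat.div_div_eq_div_mul, ← pow_succ', show d - 1 - j + 1 = d + 1 - 1 - j by omega]
    rw [hsum]
    have hsplit : 2 * ∑ j ∈ Finset.range d, w j * 2 ^ (d - 1 - j) + w d = a ↔
        ∑ j ∈ Finset.range d, w j * 2 ^ (d - 1 - j) = a / 2 ∧ w d = a % 2 := by
      omega
    rw [hsplit, hih]
    constructor
    · rintro ⟨h1, h2⟩ j hj
      rcases Nat.lt_or_ge j d with h | h
      · rw [h1 j h, hdig j h]
      · obtain rfl : j = d := by omega
        simpa using h2
    · intro h
      refine ⟨fun j hj => ?_, by simpa using h d (by omega)⟩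
      rw [h j (by omega), hdig j hj]

theorem sum_binary_fraction_lt_one {w : ℕ → ℕ} (hw : ∀ j, w j < 2) (M : ℕ) :
    ∑ j ∈ Finset.range M, (w j : ℝ) / 2 ^ (j + 1) < 1 := by
  suffices h : ∑ j ∈ Finset.range M, (w j : ℝ) / 2 ^ (j + 1) ≤ 1 - 1 / 2 ^ M by
    have : (0 : ℝ) < 1 / 2 ^ M := by positivity
    linarith
  induction M with
  | zero => simp
  | succ M ih =>
    rw [Finset.sum_range_succ]
    have h1 : (w M : ℝ) ≤ 1 := by exact_mod_cast Nat.lt_succ_iff.mp (hw M)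
    have h2 : (w M : ℝ) / 2 ^ (M + 1) ≤ 1 / 2 ^ (M + 1) := by gcongr
    have h3 : (1 : ℝ) / 2 ^ M = 2 * (1 / 2 ^ (M + 1)) := by rw [pow_succ]; field_simp
    linarith

/-- A dyadic rational lies in an elementary interval iff its leading digits are prescribed. -/
theorem tsum_binary_mem_interval_iff {w : ℕ → ℕ} (hw : ∀ j, w j < 2) {M : ℕ}
    (hM : ∀ j, M ≤ j → w j = 0) {d a : ℕ} (ha : a < 2 ^ d) :
    ((a : ℝ) / 2 ^ d ≤ ∑' j, (w j : ℝ) / 2 ^ (j + 1) ∧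
      ∑' j, (w j : ℝ) / 2 ^ (j + 1) < ((a : ℝ) + 1) / 2 ^ d) ↔
      ∀ j, j < d → w j = a / 2 ^ (d - 1 - j) % 2 := by
  have htsum : ∑' j, (w j : ℝ) / 2 ^ (j + 1) =
      ∑ j ∈ Finset.range (d + M), (w j : ℝ) / 2 ^ (j + 1) := by
    refine tsum_eq_sum fun j hj => ?_
    rw [Finset.mem_range, not_lt] at hj
    rw [hM j (by omega), Nat.cast_zero, zero_div]
  set A : ℕ := ∑ j ∈ Finset.range d, w j * 2 ^ (d - 1 - j) with hA
  set ε : ℝ := ∑ k ∈ Finset.range M, (w (d + k) : ℝ) / 2 ^ (k + 1) with hε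
  have hε0 : 0 ≤ ε := Finset.sum_nonneg fun k _ => by positivity
  have hε1 : ε < 1 := sum_binary_fraction_lt_one (fun k => hw (d + k)) M
  have hval : ∑' j, (w j : ℝ) / 2 ^ (j + 1) = (A + ε) / 2 ^ d := by
    rw [htsum, Finset.sum_range_add, add_div, hA, hε, Finset.sum_div, Nat.cast_sum,
      Finset.sum_div]
    congr 1
    · refine Finset.sum_congr rfl fun j hj => ?_
      rw [Finset.mem_range] at hj
      have h : (2 : ℝ) ^ d = 2 ^ (d - 1 - j) * 2 ^ (j + 1) := by
        rw [← pow_add]; congr 1; omega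
      rw [h]
      push_cast
      field_simp
    · refine Finset.sum_congr rfl fun k _ => ?_
      rw [div_div, ← pow_add]
      congr 2
      omega
  have h2 : (0 : ℝ) < 2 ^ d := by positivity
  rw [hval, div_le_div_iff_of_pos_right h2, div_lt_div_iff_of_pos_right h2,
    ← sum_binary_digits_eq_iff hw d a ha, ← hA]
  constructor
  · rintro ⟨h3, h4⟩
    have h5 : (a : ℝ) < (A + 1 : ℕ) := by push_cast; linarith
    have h6 : (A : ℝ) < (a + 1 : ℕ) := by push_cast; linarith
    have h7 := Nat.cast_lt.mp h5
    have h8 := Nat.cast_lt.mp h6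
    omega
  · rintro rfl
    exact ⟨by linarith, by linarith⟩

/-- The digit sum of `ℓ * 2 ^ m + k` splits into the parts of `k` and of `ℓ`. -/
theorem sum_binary_digits_block {R : Type*} [Semiring R] (c : ℕ → R) {ℓ m k : ℕ}
    (hk : k < 2 ^ m) :
    ∑ r ∈ Finset.range (ℓ * 2 ^ m + k + 1), c r * (((ℓ * 2 ^ m + k) / 2 ^ r % 2 : ℕ) : R) =
      ∑ r : Fin m, c r * ((k / 2 ^ (r : ℕ) % 2 : ℕ) : R) +
        ∑ r ∈ Finset.range ℓ, c (m + r) * ((ℓ / 2 ^ r % 2 : ℕ) : R) := by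
  set n := ℓ * 2 ^ m + k with hn
  have hhigh : ∀ r, n / 2 ^ (m + r) = ℓ / 2 ^ r := fun r => by
    rw [pow_add, ← Nat.div_div_eq_div_mul, hn, mul_comm ℓ, Nat.mul_add_div (by positivity),
      Nat.div_eq_of_lt hk, add_zero]
  have hlow : ∀ r, r < m → n / 2 ^ r % 2 = k / 2 ^ r % 2 := fun r hr => by
    obtain ⟨q, rfl⟩ : ∃ q, m = r + (q + 1) := ⟨m - r - 1, by omega⟩
    have h : n = 2 ^ r * (2 * (ℓ * 2 ^ q)) + k := by rw [hn]; ring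
    rw [h, Nat.mul_add_div (by positivity), Nat.mul_add_mod]
  have hzero : ∀ r, m + ℓ ≤ r → n / 2 ^ r = 0 := fun r hr => by
    obtain ⟨q, rfl⟩ : ∃ q, r = m + q := ⟨r - m, by omega⟩
    rw [hhigh, Nat.div_eq_of_lt]
    exact lt_of_lt_of_le Nat.lt_two_pow_self (Nat.pow_le_pow_right (by norm_num) (by omega))
  have hzero' : ∀ r, n + 1 ≤ r → n / 2 ^ r = 0 := fun r hr =>
    Nat.div_eq_of_lt (lt_of_lt_of_le Nat.lt_two_pow_self
      (Nat.pow_le_pow_right (by norm_num) (by omega)))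
  have hext : ∀ N, (∀ r, N ≤ r → n / 2 ^ r = 0) → ∀ T, N ≤ T →
      ∑ r ∈ Finset.range N, c r * ((n / 2 ^ r % 2 : ℕ) : R) =
        ∑ r ∈ Finset.range T, c r * ((n / 2 ^ r % 2 : ℕ) : R) := fun N hN T hT => by
    refine Finset.sum_subset (Finset.range_mono hT) fun r _ hr => ?_
    rw [Finset.mem_range, not_lt] at hr
    simp [hN r hr]
  rw [hext _ hzero' (n + 1 + (m + ℓ)) (by omega), ← hext _ hzero _ (by omega),
    Finset.sum_range_add, Fin.sum_univ_eq_sum_range (fun r => c r * ((k / 2 ^ r % 2 : ℕ) : R))]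
  congr 1
  · exact Finset.sum_congr rfl fun r hr => by rw [hlow r (Finset.mem_range.mp hr)]
  · exact Finset.sum_congr rfl fun r _ => by rw [hhigh r]

/-- Binary digits identify a dyadic block of natural numbers with vectors over `ℤ/2ℤ`. -/
theorem card_dyadic_block (m ℓ : ℕ) (Q : ℕ → Prop) (S : (Fin m → ZMod 2) → Prop)
    (h : ∀ k, k < 2 ^ m →
      (Q (ℓ * 2 ^ m + k) ↔ S fun r => ((k / 2 ^ (r : ℕ) % 2 : ℕ) : ZMod 2))) :
    Nat.card {n : ℕ // (ℓ * 2 ^ m ≤ n ∧ n < (ℓ + 1) * 2 ^ m) ∧ Q n} =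
      Nat.card {g : Fin m → ZMod 2 // S g} := by
  let E : (Fin m → ZMod 2) ≃ Fin (2 ^ m) := finFunctionFinEquiv (m := 2) (n := m)
  have hE : ∀ k : Fin (2 ^ m), E.symm k = fun r : Fin m => (((k : ℕ) / 2 ^ (r : ℕ) % 2 : ℕ) : ZMod 2) := by
    intro k
    funext r
    apply ZMod.val_injective 2
    rw [ZMod.val_natCast, Nat.mod_mod]
    exact finFunctionFinEquiv_symm_apply_val (m := 2) (n := m) k r
  have hcard : Nat.card {k : Fin (2 ^ m) // Q (ℓ * 2 ^ m + k)} =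
      Nat.card {g : Fin m → ZMod 2 // S g} :=
    Nat.card_congr (E.symm.subtypeEquiv fun k => by rw [hE, h k k.2])
  rw [← hcard]
  refine Nat.card_congr
    { toFun := fun n => ⟨⟨n.1 - ℓ * 2 ^ m, ?_⟩, ?_⟩
      invFun := fun k => ⟨ℓ * 2 ^ m + k.1, ⟨by omega, ?_⟩, k.2⟩
      left_inv := fun n => Subtype.ext ?_
      right_inv := fun k => Subtype.ext (Fin.ext ?_) }
  · have h1 := n.2.1.1
    have h2 := n.2.1.2.trans_eq (add_one_mul ℓ (2 ^ m))
    omega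
  · have := n.2.1.1
    simpa only [Nat.add_sub_cancel' this] using n.2.2
  · rw [add_mul, one_mul]
    have := k.1.2
    omega
  · exact Nat.add_sub_cancel' n.2.1.1
  · exact Nat.add_sub_cancel_left _ _


/-- let `p₁,…,p_s` be pairwise distinct monic polynomials over `ℤ/2ℤ` of
degrees `e₁,…,e_s ≥ 1`, each either equal to `X` or primitive (irreducible, with the class
of `X` in `(ℤ/2ℤ)[X]/(p_i)` of multiplicative order `2^{e_i} − 1`), say
`p_i(X) = X^{e_i} − a⁽ⁱ⁾_{e_i−1}X^{e_i−1} − ⋯ − a⁽ⁱ⁾_0`. For each `i` let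
`C⁽ⁱ⁾ = (v i j r)` be a Sobol' generating matrix for `p i`: its first `e_i` columns form a
nonsingular upper triangular direction matrix (for `1 ≤ r ≤ e_i`: `v i j r = 0` for `j > r`
and `v i r r ≠ 0`) and its columns satisfy the Sobol' recurrence
`v i j (r+e_i) = a⁽ⁱ⁾_{e_i−1} v i j (r+e_i−1) + ⋯ + a⁽ⁱ⁾_0 v i j r + v i (j−e_i) r` (with
`v i (j−e_i) r = 0` for `j ≤ e_i`). Let `x` be the associated digital sequence in base 2 and
`t = Σ_i (e_i − 1)`. Then `x` is a `(t,s)`-sequence in base 2: for every `m ≥ t`, `ℓ ≥ 0`,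
`d₁,…,d_s ≥ 0` with `Σ d_i = m − t`, and `0 ≤ a_i < 2^{d_i}`, exactly `2^t` of the points
`x_n` with `ℓ·2^m ≤ n < (ℓ+1)·2^m` lie in the box `Π_i [a_i 2^{−d_i}, (a_i+1) 2^{−d_i})`. -/
theorem stmt_14 (s : ℕ) (hs : 1 ≤ s)
    (p : Fin s → Polynomial (ZMod 2))
    (hmonic : ∀ i, (p i).Monic)
    (e : Fin s → ℕ) (he : ∀ i, 1 ≤ e i) (hdeg : ∀ i, e i = (p i).natDegree)
    (hdist : ∀ i i', i ≠ i' → p i ≠ p i')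
    (hprim : ∀ i, p i = Polynomial.X ∨
      (Irreducible (p i) ∧ orderOf (AdjoinRoot.root (p i)) = 2 ^ e i - 1))
    (a : Fin s → ℕ → ZMod 2)
    (ha : ∀ i, p i = Polynomial.X ^ e i -
      ∑ k ∈ Finset.range (e i), Polynomial.C (a i k) * Polynomial.X ^ k)
    (v : Fin s → ℕ → ℕ → ZMod 2)
    (hNUT : ∀ i r, 1 ≤ r → r ≤ e i → (∀ j, r < j → v i j r = 0) ∧ v i r r ≠ 0)
    (hrec : ∀ i j r, 1 ≤ j → 1 ≤ r →
      v i j (r + e i) = (∑ k ∈ Finset.range (e i), a i k * v i j (r + k)) +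
        (if e i < j then v i (j - e i) r else 0))
    (y : Fin s → ℕ → ℕ → ZMod 2)
    (hy : ∀ i j n, y i j n =
      ∑ r ∈ Finset.range (n + 1), v i j (r + 1) * ((n / 2 ^ r % 2 : ℕ) : ZMod 2))
    (x : Fin s → ℕ → ℝ)
    (hx : ∀ i n, x i n = ∑' j : ℕ, ((y i (j + 1) n).val : ℝ) / (2 : ℝ) ^ (j + 1))
    (t : ℕ) (ht : t = ∑ i, (e i - 1)) :
    ∀ m, t ≤ m → ∀ ℓ : ℕ, ∀ d : Fin s → ℕ, (∑ i, d i) = m - t →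
      ∀ aa : Fin s → ℕ, (∀ i, aa i < 2 ^ d i) →
        Nat.card {n : ℕ // (ℓ * 2 ^ m ≤ n ∧ n < (ℓ + 1) * 2 ^ m) ∧
          ∀ i, (aa i : ℝ) / (2 : ℝ) ^ d i ≤ x i n ∧
            x i n < ((aa i : ℝ) + 1) / (2 : ℝ) ^ d i} = 2 ^ t := by
  intro m hm ℓ d hd aa haa
  have hirr : ∀ i, Irreducible (p i) := fun i => by
    rcases hprim i with h | h
    · rw [h]; exact Polynomial.irreducible_X
    · exact h.1
  have hinj : Function.Injective p := fun i i' h => by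
    by_contra hne
    exact hdist i i' hne h
  have hyzero : ∀ i j n, n + 1 < j → y i j n = 0 := fun i j n hj => by
    rw [hy]
    refine Finset.sum_eq_zero fun r hr => ?_
    rw [Finset.mem_range] at hr
    rw [(sobol_upper_triangular (he i) (hNUT i) (hrec i) (r + 1) (by omega)).1 j (by omega),
      zero_mul]
  let M : Matrix (Σ i, Fin (d i)) (Fin m) (ZMod 2) := fun ij r => v ij.1 (ij.2 + 1) (r + 1)
  let b : (Σ i, Fin (d i)) → ZMod 2 := fun ij =>
    ((aa ij.1 / 2 ^ (d ij.1 - 1 - ij.2) % 2 : ℕ) : ZMod 2) -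
      ∑ r ∈ Finset.range ℓ, v ij.1 (ij.2 + 1) (m + r + 1) * ((ℓ / 2 ^ r % 2 : ℕ) : ZMod 2)
  have hsurj : Function.Surjective M.mulVec := fun c => by
    obtain ⟨g, hg⟩ := sobol_rows_surjective hmonic hirr hinj he hdeg ha hNUT hrec
      (d := d) (m := m) (by omega) (fun i j => if h : j < d i then c ⟨i, j, h⟩ else 0)
    refine ⟨g, funext fun ⟨i, j⟩ => ?_⟩
    exact (hg i j j.2).trans (dif_pos j.2)
  rw [← card_solutions_of_surjective (t := t) (by simp; omega) M hsurj b]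
  refine card_dyadic_block m ℓ _ _ fun k hk => ?_
  set n := ℓ * 2 ^ m + k with hn
  have hbox : ∀ i, ((aa i : ℝ) / (2 : ℝ) ^ d i ≤ x i n ∧
      x i n < ((aa i : ℝ) + 1) / (2 : ℝ) ^ d i) ↔
      ∀ j, j < d i → (y i (j + 1) n).val = aa i / 2 ^ (d i - 1 - j) % 2 := fun i => by
    rw [hx]
    exact tsum_binary_mem_interval_iff (w := fun j => (y i (j + 1) n).val)
      (fun j => ZMod.val_lt _) (M := n + 1)
      (fun j hj => by simp [hyzero i (j + 1) n (by omega)]) (haa i)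
  have hval : ∀ (z : ZMod 2) (c : ℕ), z.val = c % 2 ↔ z = ((c % 2 : ℕ) : ZMod 2) := by
    intro z c
    rw [← (ZMod.val_injective 2).eq_iff, ZMod.val_natCast, Nat.mod_mod]
  simp only [hbox, hval]
  rw [funext_iff, Sigma.forall]
  refine forall_congr' fun i => ?_
  rw [Fin.forall_iff]
  refine forall_congr' fun j => forall_congr' fun hj => ?_
  rw [hy, hn, sum_binary_digits_block (fun r => v i (j + 1) (r + 1)) hk]
  exact eq_sub_iff_add_eq.symm
end
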